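/- arXiv:2005.14384 — 3 statements merged into one kernel-verified Lean document; each statement's English description precedes it below -/
import Mathlib

section
/- Let r ≥ 4 be an integer, μ > 0, and A ⊆ [n] with s(A) ≥ μn². Then g(A, r) ≤ r^{|A| - (3(2·log₂ r - log₂(3r-2))/(2·log₂ r))·μn}. -/
open Finset

/-- The set of restricted Schur triples of `A`: ordered triples `(a, b, c)` of
elements of `A` with `a < b < c` and `a + b = c`. -/
def restrictedSchurTriples (A : Finset ℕ) : Finset (ℕ × ℕ × ℕ) :=
  (A ×ˢ A ×ˢ A).filter
    (fun t => t.1 < t.2.1 ∧ t.2.1 < t.2.2 ∧ t.1 + t.2.1 = t.2.2)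

/-- `s(A)`: the number of restricted Schur triples of `A`. -/
def numST (A : Finset ℕ) : ℕ := (restrictedSchurTriples A).card

/-- The number of rainbow sum-free `r`-colorings of a finite set `A` of positive
integers. -/
noncomputable def numRSF (r : ℕ) (A : Finset ℕ) : ℕ :=
  Nat.card {f : ↥A → Fin r //
    ∀ x y z : ↥A, (x : ℕ) + (y : ℕ) = (z : ℕ) →
      ¬(f x ≠ f y ∧ f x ≠ f z ∧ f y ≠ f z)}

/-- Given one colour of a triple, at most `3r - 2` colour pairs make the triple non-rainbow. -/
lemma card_nonrainbow_pairs_le (r : ℕ) (hr : 4 ≤ r) (c : Fin r) :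
    #{u : Fin r × Fin r | ¬(c ≠ u.1 ∧ c ≠ u.2 ∧ u.1 ≠ u.2)} ≤ 3 * r - 2 := by
  have hcompl := Finset.card_filter_add_card_filter_not
    (s := (univ : Finset (Fin r × Fin r))) (fun u => c ≠ u.1 ∧ c ≠ u.2 ∧ u.1 ≠ u.2)
  have hoff : ({u : Fin r × Fin r | c ≠ u.1 ∧ c ≠ u.2 ∧ u.1 ≠ u.2} : Finset _)
      = (univ.erase c).offDiag := by
    ext u
    simp [mem_offDiag, eq_comm]
  rw [hoff, offDiag_card, card_erase_of_mem (mem_univ c)] at hcompl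
  simp only [card_univ, Fintype.card_prod, Fintype.card_fin] at hcompl
  obtain ⟨k, rfl⟩ : ∃ k, r = k + 1 := ⟨r - 1, by omega⟩
  have hsub : k * k - k + k = k * k := Nat.sub_add_cancel (Nat.le_mul_self k)
  simp only [Nat.add_sub_cancel] at hcompl
  have : (k + 1) * (k + 1) = k * k + 2 * k + 1 := by ring
  omega

/-- The colourings in which no pair of `M` forms a rainbow triple with `x`. -/
def nonrainbowColorings {α : Type*} [Fintype α] [DecidableEq α] (r : ℕ) (x : α)
    (M : Finset (α × α)) : Finset (α → Fin r) :=
  {f | ∀ p ∈ M, ¬(f x ≠ f p.1 ∧ f x ≠ f p.2 ∧ f p.1 ≠ f p.2)}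

lemma card_nonrainbowColorings_insert {α : Type*} [Fintype α] [DecidableEq α] {r : ℕ}
    (hr : 4 ≤ r) {x y z : α} {M : Finset (α × α)} (hxy : y ≠ x) (hxz : z ≠ x) (hyz : y ≠ z)
    (hM : ∀ q ∈ M, q.1 ≠ y ∧ q.1 ≠ z ∧ q.2 ≠ y ∧ q.2 ≠ z) :
    #(nonrainbowColorings r x (insert (y, z) M)) * r ^ 2 ≤
      #(nonrainbowColorings r x M) * (3 * r - 2) := by
  classical
  let good : Fin r → Finset (Fin r × Fin r) :=
    fun c => {u | ¬(c ≠ u.1 ∧ c ≠ u.2 ∧ u.1 ≠ u.2)}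
  have hle : #(nonrainbowColorings r x (insert (y, z) M) ×ˢ (univ : Finset (Fin r × Fin r))) ≤
      #((nonrainbowColorings r x M).sigma fun f => good (f x)) := by
    refine card_le_card_of_injOn
      (fun w => ⟨Function.update (Function.update w.1 y w.2.1) z w.2.2, (w.1 y, w.1 z)⟩) ?_ ?_
    · rintro ⟨f, u, v⟩ hf
      simp only [nonrainbowColorings, coe_product, Set.mem_prod, mem_coe, mem_filter, mem_univ,
        true_and, and_true, mem_insert, forall_eq_or_imp] at hf
      simp only [mem_coe, mem_sigma, nonrainbowColorings, mem_filter, mem_univ, true_and, good]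
      refine ⟨fun q hq => ?_, ?_⟩
      · obtain ⟨h1, h2, h3, h4⟩ := hM q hq
        simpa [Function.update_of_ne, h1, h2, h3, h4, hxy.symm, hxz.symm] using hf.2 q hq
      · simpa [Function.update_of_ne, hxy.symm, hxz.symm] using hf.1
    · rintro ⟨f, u, v⟩ - ⟨g, u', v'⟩ - h
      simp only [Sigma.mk.injEq, heq_eq_eq, Prod.mk.injEq] at h
      obtain ⟨h, hy, hz⟩ := h
      have hv : v = v' := by simpa using congrFun h z
      have hu : u = u' := by simpa [Function.update_of_ne, hyz] using congrFun h y
      have hf : f = g := by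
        ext1 a
        by_cases ha : a = y
        · rw [ha, hy]
        by_cases hb : a = z
        · rw [hb, hz]
        simpa [Function.update_of_ne, ha, hb] using congrFun h a
      rw [hf, hu, hv]
  rw [card_product, card_sigma, card_univ, Fintype.card_prod, Fintype.card_fin, ← sq] at hle
  refine hle.trans ?_
  rw [← smul_eq_mul]
  exact sum_le_card_nsmul _ _ _ fun f _ => card_nonrainbow_pairs_le r hr (f x)

lemma card_nonrainbowColorings_le {α : Type*} [Fintype α] [DecidableEq α] {r : ℕ}
    (hr : 4 ≤ r) {x : α} (M : Finset (α × α))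
    (hx : ∀ p ∈ M, p.1 ≠ x ∧ p.2 ≠ x ∧ p.1 ≠ p.2)
    (hM : ∀ p ∈ M, ∀ q ∈ M, q ≠ p → q.1 ≠ p.1 ∧ q.1 ≠ p.2 ∧ q.2 ≠ p.1 ∧ q.2 ≠ p.2) :
    #(nonrainbowColorings r x M) * r ^ (2 * #M) ≤ r ^ Fintype.card α * (3 * r - 2) ^ #M := by
  induction M using Finset.induction_on with
  | empty => simp [nonrainbowColorings]
  | insert p M hp ih =>
    have hstep : #(nonrainbowColorings r x (insert p M)) * r ^ 2 ≤
        #(nonrainbowColorings r x M) * (3 * r - 2) := by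
      obtain ⟨h1, h2, h3⟩ := hx p (mem_insert_self p M)
      exact card_nonrainbowColorings_insert hr h1 h2 h3 fun q hq =>
        hM p (mem_insert_self p M) q (mem_insert_of_mem hq) (ne_of_mem_of_not_mem hq hp)
    have hrec := ih (fun q hq => hx q (mem_insert_of_mem hq))
      (fun q hq q' hq' => hM q (mem_insert_of_mem hq) q' (mem_insert_of_mem hq'))
    rw [card_insert_of_notMem hp]
    calc _ = #(nonrainbowColorings r x (insert p M)) * r ^ 2 * r ^ (2 * #M) := by ring
      _ ≤ #(nonrainbowColorings r x M) * (3 * r - 2) * r ^ (2 * #M) := by gcongr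
      _ = #(nonrainbowColorings r x M) * r ^ (2 * #M) * (3 * r - 2) := by ring
      _ ≤ r ^ Fintype.card α * (3 * r - 2) ^ #M * (3 * r - 2) := by gcongr
      _ = _ := by ring

/-- The pairs of elements of `A` completing `x` to a Schur triple of distinct elements. -/
def schurLink (A : Finset ℕ) (x : ℕ) : Finset (ℕ × ℕ) :=
  (A ×ˢ A).filter
    (fun p => p.1 < p.2 ∧ p.1 ≠ x ∧ p.2 ≠ x ∧ (p.1 + x = p.2 ∨ p.1 + p.2 = x))

lemma three_mul_numST_le (A : Finset ℕ) (hpos : ∀ a ∈ A, 0 < a) :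
    3 * numST A ≤ ∑ x ∈ A, #(schurLink A x) := by
  set T := restrictedSchurTriples A with hT
  have h1 : numST A = ∑ x ∈ A, #{t ∈ T | t.1 = x} :=
    card_eq_sum_card_fiberwise fun t ht => by
      simp [restrictedSchurTriples] at ht; simp [ht]
  have h2 : numST A = ∑ x ∈ A, #{t ∈ T | t.2.1 = x} :=
    card_eq_sum_card_fiberwise fun t ht => by
      simp [restrictedSchurTriples] at ht; simp [ht]
  have h3 : numST A = ∑ x ∈ A, #{t ∈ T | t.2.2 = x} :=
    card_eq_sum_card_fiberwise fun t ht => by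
      simp [restrictedSchurTriples] at ht; simp [ht]
  have hsum : 3 * numST A = ∑ x ∈ A,
      (#{t ∈ T | t.1 = x} + #{t ∈ T | t.2.1 = x} + #{t ∈ T | t.2.2 = x}) := by
    rw [sum_add_distrib, sum_add_distrib, ← h1, ← h2, ← h3]
    ring
  rw [hsum]
  refine sum_le_sum fun x hx => ?_
  have hx0 := hpos x hx
  have hfirst : #{t ∈ T | t.1 = x} ≤ #{p ∈ schurLink A x | p.1 + p.2 ≠ x ∧ x < p.1} := by
    refine card_le_card_of_injOn (fun t => (t.2.1, t.2.2)) ?_ ?_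
    · rintro ⟨a, b, c⟩ h
      simp [hT, restrictedSchurTriples, schurLink] at h ⊢
      grind
    · rintro ⟨a, b, c⟩ h ⟨a', b', c'⟩ h' e
      simp at h h' e ⊢
      grind
  have hsecond : #{t ∈ T | t.2.1 = x} ≤ #{p ∈ schurLink A x | p.1 + p.2 ≠ x ∧ ¬ x < p.1} := by
    refine card_le_card_of_injOn (fun t => (t.1, t.2.2)) ?_ ?_
    · rintro ⟨a, b, c⟩ h
      simp [hT, restrictedSchurTriples, schurLink] at h ⊢
      grind
    · rintro ⟨a, b, c⟩ h ⟨a', b', c'⟩ h' e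
      simp at h h' e ⊢
      grind
  have hthird : #{t ∈ T | t.2.2 = x} ≤ #{p ∈ schurLink A x | ¬ p.1 + p.2 ≠ x} := by
    refine card_le_card_of_injOn (fun t => (t.1, t.2.1)) ?_ ?_
    · rintro ⟨a, b, c⟩ h
      simp [hT, restrictedSchurTriples, schurLink] at h ⊢
      grind
    · rintro ⟨a, b, c⟩ h ⟨a', b', c'⟩ h' e
      simp at h h' e ⊢
      grind
  have hsplit := card_filter_add_card_filter_not (s := schurLink A x) (fun p => p.1 + p.2 ≠ x)
  have hsplit' := card_filter_add_card_filter_not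
    (s := {p ∈ schurLink A x | p.1 + p.2 ≠ x}) (fun p => x < p.1)
  rw [filter_filter, filter_filter] at hsplit'
  omega

/-- The link graph of `x` is a union of paths, so at least half of its edges form a matching. -/
lemma exists_matching_schurLink (A : Finset ℕ) {x : ℕ} (hx : 0 < x) :
    ∃ M ⊆ schurLink A x, #(schurLink A x) ≤ 2 * #M ∧
      ∀ p ∈ M, ∀ q ∈ M, q ≠ p → q.1 ≠ p.1 ∧ q.1 ≠ p.2 ∧ q.2 ≠ p.1 ∧ q.2 ≠ p.2 := by
  classical
  obtain ⟨P, hP⟩ : ∃ P : ℕ × ℕ → Prop, ∀ p, P p ↔ p.1 + p.2 ≠ x ∧ p.1 / x % 2 = 0 :=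
    ⟨_, fun _ => Iff.rfl⟩
  have hsplit : #{p ∈ schurLink A x | P p} + #{p ∈ schurLink A x | ¬ P p} =
      #(schurLink A x) := card_filter_add_card_filter_not _
  have hdiv : ∀ a, (a + x) / x = a / x + 1 := fun a => Nat.add_div_right a hx
  have hsmall : ∀ a, a < x → a / x = 0 := fun a ha => Nat.div_eq_of_lt ha
  rcases le_total #{p ∈ schurLink A x | P p} #{p ∈ schurLink A x | ¬ P p} with hle | hle
  · refine ⟨_, filter_subset (fun p => ¬ P p) _, by omega, ?_⟩
    rintro ⟨a, b⟩ hp ⟨c, d⟩ hq hne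
    simp only [schurLink, mem_filter, mem_product, hP] at hp hq
    have := hdiv a
    have := hdiv c
    have := hsmall a
    have := hsmall b
    have := hsmall c
    have := hsmall d
    have : ¬ (c = a ∧ d = b) := by simpa using hne
    obtain ⟨-, h1, h2, h3, h4⟩ := hp.1
    obtain ⟨-, h5, h6, h7, h8⟩ := hq.1
    have h9 := hp.2
    have h10 := hq.2
    rcases h4 with rfl | h4 <;> rcases h8 with rfl | h8 <;>
      refine ⟨?_, ?_, ?_, ?_⟩ <;> dsimp only at * <;> intro h <;> grind
  · refine ⟨_, filter_subset (fun p => P p) _, by omega, ?_⟩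
    rintro ⟨a, b⟩ hp ⟨c, d⟩ hq hne
    simp only [schurLink, mem_filter, mem_product, hP] at hp hq
    have := hdiv a
    have := hdiv c
    have : ¬ (c = a ∧ d = b) := by simpa using hne
    refine ⟨?_, ?_, ?_, ?_⟩ <;> dsimp only at * <;> intro h <;> grind

lemma numRSF_mul_le {r : ℕ} (hr : 4 ≤ r) {A : Finset ℕ} {x : ℕ} (hx : x ∈ A)
    {M : Finset (ℕ × ℕ)} (hsub : M ⊆ schurLink A x)
    (hM : ∀ p ∈ M, ∀ q ∈ M, q ≠ p → q.1 ≠ p.1 ∧ q.1 ≠ p.2 ∧ q.2 ≠ p.1 ∧ q.2 ≠ p.2) :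
    numRSF r A * r ^ (2 * #M) ≤ r ^ #A * (3 * r - 2) ^ #M := by
  classical
  let M' : Finset (↥A × ↥A) := {p | ((p.1 : ℕ), (p.2 : ℕ)) ∈ M}
  have hlink : ∀ p ∈ M, p.1 ∈ A ∧ p.2 ∈ A ∧ p.1 < p.2 ∧ p.1 ≠ x ∧ p.2 ≠ x ∧
      (p.1 + x = p.2 ∨ p.1 + p.2 = x) := fun p hp => by
    simpa [schurLink, and_assoc] using hsub hp
  have hinj : Function.Injective fun p : ↥A × ↥A => ((p.1 : ℕ), (p.2 : ℕ)) :=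
    Subtype.val_injective.prodMap Subtype.val_injective
  have hcard : #M' = #M := by
    refine card_bij (fun p _ => ((p.1 : ℕ), (p.2 : ℕ))) (fun p hp => by simpa [M'] using hp)
      (fun p _ q _ h => hinj h) fun p hp => ?_
    exact ⟨(⟨p.1, (hlink p hp).1⟩, ⟨p.2, (hlink p hp).2.1⟩), by simpa [M'] using hp, rfl⟩
  have hbound := card_nonrainbowColorings_le hr (x := (⟨x, hx⟩ : ↥A)) M'
    (fun p hp => by
      have := hlink _ (mem_filter.1 hp).2
      simp only [ne_eq, Subtype.ext_iff]
      omega)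
    (fun p hp q hq hne => by
      have := hM _ (mem_filter.1 hp).2 _ (mem_filter.1 hq).2
        (fun h => hne (hinj h))
      simpa only [ne_eq, Subtype.ext_iff] using this)
  rw [hcard, Fintype.card_coe] at hbound
  refine le_trans (Nat.mul_le_mul_right _ ?_) hbound
  rw [numRSF, Nat.card_eq_fintype_card, Fintype.card_subtype]
  refine card_le_card fun f hf => ?_
  simp only [mem_filter, mem_univ, true_and, nonrainbowColorings] at hf ⊢
  intro p hp
  rcases (hlink _ (mem_filter.1 hp).2).2.2.2.2.2 with h | h
  · have := hf p.1 ⟨x, hx⟩ p.2 h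
    grind
  · have := hf p.1 p.2 ⟨x, hx⟩ h
    grind

theorem stmt_17 (n r : ℕ) (hr : 4 ≤ r) (μ : ℝ) (hμ : 0 < μ)
    (A : Finset ℕ) (hA : A ⊆ Finset.Icc 1 n)
    (hs : μ * (n : ℝ) ^ 2 ≤ (numST A : ℝ)) :
    (numRSF r A : ℝ) ≤
      (r : ℝ) ^ ((A.card : ℝ) -
        3 * (2 * Real.logb 2 r - Real.logb 2 (3 * r - 2)) / (2 * Real.logb 2 r)
          * μ * n) := by
  have hpos : ∀ a ∈ A, 0 < a := fun a ha => (mem_Icc.1 (hA ha)).1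
  have hr0 : (0 : ℝ) < r := by positivity
  have hr4 : (4 : ℝ) ≤ r := by exact_mod_cast hr
  rcases Nat.eq_zero_or_pos n with rfl | hn
  · obtain rfl : A = ∅ := by simpa using hA
    have : numRSF r ∅ ≤ 1 := by
      rw [numRSF]
      exact Finite.card_le_one_iff_subsingleton.2 inferInstance
    simpa using this
  have hn' : (0 : ℝ) < n := by exact_mod_cast hn
  obtain ⟨x, hx, hdeg⟩ : ∃ x ∈ A, 3 * μ * n ≤ (#(schurLink A x) : ℝ) := by
    by_contra! hcon
    have hsum : 3 * (numST A : ℝ) ≤ ∑ x ∈ A, (#(schurLink A x) : ℝ) := by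
      exact_mod_cast three_mul_numST_le A hpos
    have hne : A.Nonempty := by
      rw [nonempty_iff_ne_empty]
      rintro rfl
      have : (0 : ℝ) < μ * n ^ 2 := by positivity
      simp only [sum_empty] at hsum
      linarith
    have hlt := sum_lt_sum_of_nonempty hne hcon
    rw [sum_const, nsmul_eq_mul] at hlt
    have hcard : (#A : ℝ) ≤ n := by
      exact_mod_cast (card_le_card hA).trans (by simp)
    have : (#A : ℝ) * (3 * μ * n) ≤ n * (3 * μ * n) := by gcongr
    nlinarith
  obtain ⟨M, hsub, hhalf, hM⟩ := exists_matching_schurLink A (hpos x hx)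
  have hcount := numRSF_mul_le hr hx hsub hM
  have hm : 3 / 2 * μ * n ≤ (#M : ℝ) := by
    have : (#(schurLink A x) : ℝ) ≤ 2 * #M := by exact_mod_cast hhalf
    linarith
  have hcount' : (numRSF r A : ℝ) * (r : ℝ) ^ (2 * #M) ≤
      (r : ℝ) ^ #A * (3 * (r : ℝ) - 2) ^ #M := by
    have hcast : ((3 * r - 2 : ℕ) : ℝ) = 3 * (r : ℝ) - 2 := by
      rw [Nat.cast_sub (by omega)]
      push_cast
      ring
    rw [← hcast]
    exact_mod_cast hcount
  have hl : 0 < Real.logb 2 r := Real.logb_pos (by norm_num) (by linarith)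
  have hr2 : (0 : ℝ) < 3 * r - 2 := by linarith
  set D := 2 * Real.logb 2 r - Real.logb 2 (3 * r - 2) with hD
  have hD0 : 0 ≤ D := by
    have : Real.logb 2 (3 * r - 2) ≤ Real.logb 2 ((r : ℝ) ^ 2) :=
      Real.logb_le_logb_of_le (by norm_num) hr2 (by nlinarith)
    rw [Real.logb_pow] at this
    push_cast at this
    linarith
  have hpow : (3 * (r : ℝ) - 2) = (r : ℝ) ^ (2 - D / Real.logb 2 r) := by
    have he : 2 - D / Real.logb 2 r = Real.logb r (3 * r - 2) := by
      rw [hD, Real.logb, Real.logb, Real.logb]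
      have h2 : Real.log 2 ≠ 0 := (Real.log_pos (by norm_num)).ne'
      have hlr : Real.log r ≠ 0 := (Real.log_pos (by linarith)).ne'
      field_simp
      ring
    rw [he, Real.rpow_logb hr0 (by linarith) hr2]
  rw [hpow, ← Real.rpow_natCast, ← Real.rpow_natCast, ← Real.rpow_natCast, ← Real.rpow_mul hr0.le,
    ← Real.rpow_add hr0, ← le_div_iff₀ (by positivity), ← Real.rpow_sub hr0] at hcount'
  refine hcount'.trans (Real.rpow_le_rpow_of_exponent_le (by linarith) ?_)
  have hprod : D / Real.logb 2 r * (3 / 2 * μ * n) ≤ D / Real.logb 2 r * #M := by gcongr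
  have hform : 3 * D / (2 * Real.logb 2 r) * μ * n = D / Real.logb 2 r * (3 / 2 * μ * n) := by
    field_simp
  rw [hform]
  push_cast
  linarith
end

section
/- Let n, r, c be positive integers with r ≥ 8 and c > 1, and let A ⊆ [n] with |A| = ⌈n/2⌉ + c. (i) If there exists t ∈ A such that the maximum matching in the link graph L_t(A) has size at least 2(c-1), then g(A, r) < r^{⌈n/2⌉ + 1}. (ii) If there exists t ∈ A such that the maximum matching in L_t(A) has size at least 2(c-1) + 1, then g(A, r) < r^{⌈n/2⌉}·(3 - 2/r). -/
open Finset

/-- `M` is a matching in the link graph `L_t(A)`: a set of edges `{p.1, p.2}` of the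
graph on `A \ {t}` where `x ~ y` iff `{t, x, y}` are three distinct elements of `A`
forming a Schur triple, such that distinct edges of `M` share no endpoints. -/
def IsLinkMatching (A : Finset ℕ) (t : ℕ) (M : Finset (ℕ × ℕ)) : Prop :=
  (∀ p ∈ M, p.1 ∈ A ∧ p.2 ∈ A ∧ p.1 ≠ t ∧ p.2 ≠ t ∧ p.1 ≠ p.2 ∧
    (p.1 + p.2 = t ∨ t + p.1 = p.2 ∨ t + p.2 = p.1)) ∧
  (∀ p ∈ M, ∀ q ∈ M, p ≠ q →
    p.1 ≠ q.1 ∧ p.1 ≠ q.2 ∧ p.2 ≠ q.1 ∧ p.2 ≠ q.2)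

lemma IsLinkMatching.mono {A : Finset ℕ} {t : ℕ} {M M' : Finset (ℕ × ℕ)}
    (h : IsLinkMatching A t M) (hM : M' ⊆ M) : IsLinkMatching A t M' :=
  ⟨fun p hp => h.1 p (hM hp), fun p hp q hq => h.2 p (hM hp) q (hM hq)⟩

/-- The set consisting of `t` and all the endpoints of the edges in `M`. -/
def linkSupport (t : ℕ) (M : Finset (ℕ × ℕ)) : Finset ℕ :=
  insert t (M.image Prod.fst ∪ M.image Prod.snd)

lemma IsLinkMatching.linkSupport_subset {A : Finset ℕ} {t : ℕ} {M : Finset (ℕ × ℕ)}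
    (h : IsLinkMatching A t M) (ht : t ∈ A) : linkSupport t M ⊆ A := by
  intro x hx
  simp only [linkSupport, mem_insert, mem_union, mem_image] at hx
  obtain rfl | ⟨p, hp, rfl⟩ | ⟨p, hp, rfl⟩ := hx
  · exact ht
  · exact (h.1 p hp).1
  · exact (h.1 p hp).2.1

lemma IsLinkMatching.card_linkSupport {A : Finset ℕ} {t : ℕ} {M : Finset (ℕ × ℕ)}
    (h : IsLinkMatching A t M) : (linkSupport t M).card = 1 + 2 * M.card := by
  have hfst : (M.image Prod.fst).card = M.card := by
    refine card_image_of_injOn fun p hp q hq hpq => ?_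
    by_contra hne
    exact (h.2 p hp q hq hne).1 hpq
  have hsnd : (M.image Prod.snd).card = M.card := by
    refine card_image_of_injOn fun p hp q hq hpq => ?_
    by_contra hne
    exact (h.2 p hp q hq hne).2.2.2 hpq
  have hdisj : Disjoint (M.image Prod.fst) (M.image Prod.snd) := by
    simp only [disjoint_left, mem_image]
    rintro _ ⟨p, hp, rfl⟩ ⟨q, hq, hpq⟩
    by_cases hne : p = q
    · subst hne
      exact (h.1 p hp).2.2.2.2.1 hpq.symm
    · exact (h.2 p hp q hq hne).2.1 hpq.symm
  have ht : t ∉ M.image Prod.fst ∪ M.image Prod.snd := by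
    simp only [mem_union, mem_image]
    rintro (⟨p, hp, hpt⟩ | ⟨p, hp, hpt⟩)
    · exact (h.1 p hp).2.2.1 hpt
    · exact (h.1 p hp).2.2.2.1 hpt
  rw [linkSupport, card_insert_of_notMem ht, card_union_of_disjoint hdisj, hfst, hsnd]
  ring

/-- The pairs of colors that do not form a rainbow triple together with `k`. -/
abbrev NonRainbowPair {r : ℕ} (k : Fin r) : Type :=
  {q : Fin r × Fin r // ¬(k ≠ q.1 ∧ k ≠ q.2 ∧ q.1 ≠ q.2)}

lemma card_nonRainbowPair_le {r : ℕ} (k : Fin r) :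
    Fintype.card (NonRainbowPair k) ≤ 3 * r - 2 := by
  rw [Fintype.card_subtype]
  have hsub : (univ.filter fun q : Fin r × Fin r => ¬(k ≠ q.1 ∧ k ≠ q.2 ∧ q.1 ≠ q.2)) ⊆
      univ.image (fun a : Fin r => (a, a)) ∪ ((univ.erase k).image (fun a => (k, a)) ∪
        (univ.erase k).image (fun a => (a, k))) := by
    rintro ⟨a, b⟩ hab
    simp only [mem_filter, mem_univ, true_and, mem_union, mem_image, mem_erase, and_true,
      Prod.mk.injEq] at hab ⊢
    by_cases hd : a = b
    · exact Or.inl ⟨a, rfl, hd⟩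
    by_cases ha : k = a
    · exact Or.inr (Or.inl ⟨b, fun hb => hd (ha.symm.trans hb.symm), ha, rfl⟩)
    · have hb : k = b := by tauto
      exact Or.inr (Or.inr ⟨a, Ne.symm ha, rfl, hb⟩)
  have hk : (univ.erase k).card = r - 1 := by simp
  have h₁ : (univ.image (fun a : Fin r => (a, a))).card ≤ r := by
    simpa using card_image_le (s := univ) (f := fun a : Fin r => (a, a))
  have h₂ := card_image_le (s := univ.erase k) (f := fun a => (k, a))
  have h₃ := card_image_le (s := univ.erase k) (f := fun a => (a, k))
  have h₄ := card_le_card hsub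
  have h₅ := card_union_le (univ.image (fun a : Fin r => (a, a)))
    ((univ.erase k).image (fun a => (k, a)) ∪ (univ.erase k).image (fun a => (a, k)))
  have h₆ := card_union_le ((univ.erase k).image (fun a => (k, a)))
    ((univ.erase k).image (fun a => (a, k)))
  have := k.pos
  omega

/-- A matching with `m` edges in a link graph leaves at most `3 * r - 2` choices for the colors
of each of its edges, once the color of `t` is fixed. -/
lemma IsLinkMatching.numRSF_le {A : Finset ℕ} {t : ℕ} {M : Finset (ℕ × ℕ)}
    (h : IsLinkMatching A t M) (ht : t ∈ A) (r : ℕ) :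
    numRSF r A ≤ r * ((3 * r - 2) ^ M.card * r ^ (A \ linkSupport t M).card) := by
  classical
  let F : {f : ↥A → Fin r // ∀ x y z : ↥A, (x : ℕ) + (y : ℕ) = (z : ℕ) →
        ¬(f x ≠ f y ∧ f x ≠ f z ∧ f y ≠ f z)} →
      Σ k : Fin r, (↥M → NonRainbowPair k) × (↥(A \ linkSupport t M) → Fin r) :=
    fun f => ⟨f.1 ⟨t, ht⟩,
      fun p => ⟨(f.1 ⟨p.1.1, (h.1 p.1 p.2).1⟩, f.1 ⟨p.1.2, (h.1 p.1 p.2).2.1⟩), by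
        obtain ⟨h₁, h₂, -, -, -, hs⟩ := h.1 p.1 p.2
        rintro ⟨hk₁, hk₂, hne⟩
        rcases hs with hs | hs | hs
        · exact f.2 ⟨_, h₁⟩ ⟨_, h₂⟩ ⟨t, ht⟩ hs ⟨hne, hk₁.symm, hk₂.symm⟩
        · exact f.2 ⟨t, ht⟩ ⟨_, h₁⟩ ⟨_, h₂⟩ hs ⟨hk₁, hk₂, hne⟩
        · exact f.2 ⟨t, ht⟩ ⟨_, h₂⟩ ⟨_, h₁⟩ hs ⟨hk₂, hk₁, hne.symm⟩⟩,
      fun x => f.1 ⟨x.1, (mem_sdiff.1 x.2).1⟩⟩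
  have hF : Function.Injective F := by
    intro f g hfg
    have hcol : ∀ k l : Fin r, ∀ u v, (⟨k, u⟩ : Σ k : Fin r, (↥M → NonRainbowPair k) ×
        (↥(A \ linkSupport t M) → Fin r)) = ⟨l, v⟩ →
        k = l ∧ (∀ p, (u.1 p).1 = (v.1 p).1) ∧ ∀ x, u.2 x = v.2 x := by
      rintro k l u v ⟨⟩
      simp
    obtain ⟨hT, hM, hR⟩ := hcol _ _ _ _ hfg
    refine Subtype.ext (funext fun ⟨x, hx⟩ => ?_)
    by_cases hxs : x ∈ linkSupport t M
    · simp only [linkSupport, mem_insert, mem_union, mem_image] at hxs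
      obtain rfl | ⟨p, hp, rfl⟩ | ⟨p, hp, rfl⟩ := hxs
      · exact hT
      · exact congrArg Prod.fst (hM ⟨p, hp⟩)
      · exact congrArg Prod.snd (hM ⟨p, hp⟩)
    · exact hR ⟨x, mem_sdiff.2 ⟨hx, hxs⟩⟩
  have hcard := Nat.card_le_card_of_injective F hF
  refine hcard.trans ?_
  rw [Nat.card_eq_fintype_card, Fintype.card_sigma]
  refine (sum_le_card_nsmul _ _ ((3 * r - 2) ^ M.card * r ^ (A \ linkSupport t M).card)
    fun k _ => ?_).trans (by simp)
  simp only [Fintype.card_prod, Fintype.card_fun, Fintype.card_coe, Fintype.card_fin]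
  gcongr
  exact card_nonRainbowPair_le k

/-- If the link graph of `t` has a matching with at least `m` edges, then at most
`r * (3 * r - 2) ^ m * r ^ e` colorings are rainbow sum-free, where `e` is the number of
elements of `A` other than `t` and the endpoints of `m` of those edges. -/
lemma exists_numRSF_le_of_le_card {A : Finset ℕ} {t m : ℕ} {M : Finset (ℕ × ℕ)}
    (h : IsLinkMatching A t M) (ht : t ∈ A) (hm : m ≤ M.card) (r : ℕ) :
    ∃ e, e + (1 + 2 * m) = A.card ∧ numRSF r A ≤ r * ((3 * r - 2) ^ m * r ^ e) := by
  obtain ⟨M', hM', rfl⟩ := exists_subset_card_eq hm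
  have h' := h.mono hM'
  refine ⟨_, ?_, h'.numRSF_le ht r⟩
  rw [← h'.card_linkSupport]
  exact card_sdiff_add_card_eq_card (h'.linkSupport_subset ht)

lemma sq_three_mul_sub_two_lt_cube {r : ℕ} (hr : 8 ≤ r) : (3 * r - 2) ^ 2 < r ^ 3 := by
  obtain ⟨s, rfl⟩ := Nat.exists_eq_add_of_le hr
  have : 3 * (8 + s) - 2 = 22 + 3 * s := by omega
  rw [this]
  nlinarith [Nat.zero_le (s ^ 3), Nat.zero_le (s ^ 2)]

theorem stmt_18 (n r c : ℕ) (hn : 0 < n) (hr : 8 ≤ r) (hc : 1 < c)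
    (A : Finset ℕ) (hA : A ⊆ Finset.Icc 1 n) (hcard : A.card = (n + 1) / 2 + c) :
    ((∃ t ∈ A, ∃ M : Finset (ℕ × ℕ), IsLinkMatching A t M ∧ 2 * (c - 1) ≤ M.card) →
      numRSF r A < r ^ ((n + 1) / 2 + 1)) ∧
    ((∃ t ∈ A, ∃ M : Finset (ℕ × ℕ), IsLinkMatching A t M ∧ 2 * (c - 1) + 1 ≤ M.card) →
      (numRSF r A : ℝ) < (r : ℝ) ^ ((n + 1) / 2) * (3 - 2 / (r : ℝ))) := by
  obtain ⟨d, rfl⟩ : ∃ d, c = d + 1 := ⟨c - 1, by omega⟩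
  have hd : d ≠ 0 := by omega
  have hpow : ((3 * r - 2) ^ 2) ^ d < (r ^ 3) ^ d :=
    Nat.pow_lt_pow_left (sq_three_mul_sub_two_lt_cube hr) hd
  simp only [Nat.add_sub_cancel]
  constructor
  · rintro ⟨t, ht, M, hM, hm⟩
    obtain ⟨e, he, hle⟩ := exists_numRSF_le_of_le_card hM ht hm r
    have hN : (n + 1) / 2 = 3 * d + e := by omega
    rw [hN]
    calc numRSF r A ≤ r * ((3 * r - 2) ^ (2 * d) * r ^ e) := hle
      _ = r ^ (e + 1) * ((3 * r - 2) ^ 2) ^ d := by ring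
      _ < r ^ (e + 1) * (r ^ 3) ^ d := by gcongr
      _ = r ^ (3 * d + e + 1) := by ring
  · rintro ⟨t, ht, M, hM, hm⟩
    obtain ⟨e, he, hle⟩ := exists_numRSF_le_of_le_card hM ht hm r
    have hN : (n + 1) / 2 = 3 * d + e + 2 := by omega
    have hq : 0 < 3 * r - 2 := by omega
    have hlt : numRSF r A < r ^ (3 * d + e + 1) * (3 * r - 2) :=
      calc numRSF r A ≤ r * ((3 * r - 2) ^ (2 * d + 1) * r ^ e) := hle
        _ = r ^ (e + 1) * (3 * r - 2) * ((3 * r - 2) ^ 2) ^ d := by ring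
        _ < r ^ (e + 1) * (3 * r - 2) * (r ^ 3) ^ d := by gcongr
        _ = r ^ (3 * d + e + 1) * (3 * r - 2) := by ring
    have hr0 : (r : ℝ) ≠ 0 := by
      have : r ≠ 0 := by omega
      exact_mod_cast this
    have hcast : ((3 * r - 2 : ℕ) : ℝ) = 3 * r - 2 := by
      rw [Nat.cast_sub (by omega)]
      norm_num
    rw [hN]
    calc (numRSF r A : ℝ) < ((r ^ (3 * d + e + 1) * (3 * r - 2) : ℕ) : ℝ) := by exact_mod_cast hlt
      _ = (r : ℝ) ^ (3 * d + e + 2) * (3 - 2 / (r : ℝ)) := by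
        rw [Nat.cast_mul, hcast, Nat.cast_pow, pow_succ _ (3 * d + e + 1)]
        field_simp
end

section
/- Let r ≥ 8 be an integer and 0 < ε ≤ 1/36. For n sufficiently large, let A ⊆ [n] with |A| = ⌈n/2⌉ + c where 1 < c ≤ εn. Suppose there exists a partition A = B ∪ C such that every element of B is odd and |C| ≤ εn. Then g(A, r) < r^{⌈n/2⌉}·(3 - 2/r). -/
open Finset

/-- If `A` contains `x` and `#L` disjoint pairs `{a, p a}`, each forming a Schur triple with `x`,
then each pair admits at most `3 * r` colorings once the color of `x` is fixed. -/
lemma numRSF_le_of_matching (r : ℕ) (A L : Finset ℕ) (p : ℕ → ℕ) (x : ℕ) (hx : x ∈ A)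
    (hxL : x ∉ L ∪ L.image p) (hinj : Set.InjOn p L) (hdisj : Disjoint L (L.image p))
    (hLA : L ⊆ A) (hpA : ∀ a ∈ L, p a ∈ A) (hsum : ∀ a ∈ L, a + p a = x ∨ a + x = p a) :
    numRSF r A ≤ r ^ (#A - 2 * #L) * (3 * r) ^ #L := by
  classical
  have hsub : L ∪ L.image p ⊆ A := by
    intro b hb
    rcases mem_union.1 hb with hb | hb
    · exact hLA hb
    · obtain ⟨a, ha, rfl⟩ := mem_image.1 hb
      exact hpA a ha
  have hcard : #(A \ (L ∪ L.image p)) = #A - 2 * #L := by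
    rw [card_sdiff_of_subset hsub, card_union_of_disjoint hdisj, card_image_of_injOn hinj]
    omega
  let X : A := ⟨x, hx⟩
  let encode : {f : ↥A → Fin r //
      ∀ x y z : ↥A, (x : ℕ) + (y : ℕ) = (z : ℕ) →
        ¬(f x ≠ f y ∧ f x ≠ f z ∧ f y ≠ f z)} →
      (↥(A \ (L ∪ L.image p)) → Fin r) × (↥L → Fin 3 × Fin r) := fun f =>
    (fun a => f.1 ⟨a, (mem_sdiff.1 a.2).1⟩,
     fun a =>
      if f.1 ⟨a, hLA a.2⟩ = f.1 ⟨p a, hpA a a.2⟩ then (0, f.1 ⟨a, hLA a.2⟩)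
      else if f.1 ⟨a, hLA a.2⟩ = f.1 X then (1, f.1 ⟨p a, hpA a a.2⟩)
      else (2, f.1 ⟨a, hLA a.2⟩))
  have henc : Function.Injective encode := by
    rintro ⟨f, hf⟩ ⟨g, hg⟩ h
    obtain ⟨h1, h2⟩ := Prod.mk.inj h
    have hrest : ∀ a (ha : a ∈ A), a ∉ L ∪ L.image p → f ⟨a, ha⟩ = g ⟨a, ha⟩ :=
      fun a ha ha' => congrFun h1 ⟨a, mem_sdiff.2 ⟨ha, ha'⟩⟩
    have hX : f X = g X := hrest x hx hxL
    have hpair : ∀ a (ha : a ∈ L), f ⟨a, hLA ha⟩ = g ⟨a, hLA ha⟩ ∧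
        f ⟨p a, hpA a ha⟩ = g ⟨p a, hpA a ha⟩ := by
      intro a ha
      have key : ∀ k : ↥A → Fin r, (∀ x y z : ↥A, (x : ℕ) + (y : ℕ) = (z : ℕ) →
          ¬(k x ≠ k y ∧ k x ≠ k z ∧ k y ≠ k z)) →
          k ⟨a, hLA ha⟩ = k ⟨p a, hpA a ha⟩ ∨ k ⟨a, hLA ha⟩ = k X ∨
            k ⟨p a, hpA a ha⟩ = k X := by
        intro k hk
        rcases hsum a ha with hs | hs
        · have := hk ⟨a, hLA ha⟩ ⟨p a, hpA a ha⟩ X hs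
          tauto
        · have := hk ⟨a, hLA ha⟩ X ⟨p a, hpA a ha⟩ hs
          have := @eq_comm _ (k X) (k ⟨p a, hpA a ha⟩)
          tauto
      have hkf := key f hf
      have hkg := key g hg
      have hE := congrFun h2 ⟨a, ha⟩
      dsimp only at hE
      split_ifs at hE <;> simp only [Prod.mk.injEq, Fin.reduceEq, false_and, true_and] at hE <;>
        grind
    apply Subtype.ext
    funext ⟨b, hb⟩
    by_cases hbU : b ∈ L ∪ L.image p
    · rcases mem_union.1 hbU with hbL | hbP
      · exact (hpair b hbL).1
      · obtain ⟨a, ha, rfl⟩ := mem_image.1 hbP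
        exact (hpair a ha).2
    · exact hrest b hb hbU
  calc numRSF r A ≤ Nat.card ((↥(A \ (L ∪ L.image p)) → Fin r) × (↥L → Fin 3 × Fin r)) :=
        Nat.card_le_card_of_injective encode henc
    _ = r ^ (#A - 2 * #L) * (3 * r) ^ #L := by
        rw [← hcard, Nat.card_prod, Nat.card_fun, Nat.card_fun]
        simp only [Nat.card_eq_fintype_card, Fintype.card_prod, Fintype.card_fin, Fintype.card_coe]

/-- For even `x ≤ n`, the odd numbers up to `n` contain about `n / 8` disjoint pairs
forming a Schur triple with `x`. -/
lemma exists_odd_matching (n x : ℕ) (hx0 : 0 < x) (hxn : x ≤ n) (hx : Even x) :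
    ∃ (L : Finset ℕ) (p : ℕ → ℕ), Set.InjOn p L ∧ Disjoint L (L.image p) ∧
      (∀ a ∈ L, Odd a ∧ a ≤ n ∧ Odd (p a) ∧ p a ≤ n ∧ (a + p a = x ∨ a + x = p a)) ∧
      n ≤ 8 * #L + 8 := by
  obtain ⟨y, rfl⟩ := hx
  rcases le_or_gt (2 * (y + y)) n with h | h
  · have hy : 0 < y := by omega
    let s : ℕ → ℕ := fun t => 2 * (2 * y * (t / y) + t % y) + 1
    have hs : ∀ t t', s t = s t' + 2 * y ∨ s t = s t' → s t = s t' ∧ t = t' := by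
      intro t t' htt
      have h1 := Nat.mod_lt t hy
      have h2 := Nat.mod_lt t' hy
      have h3 := Nat.div_add_mod t y
      have h4 := Nat.div_add_mod t' y
      simp only [s, mul_assoc] at htt ⊢
      rcases lt_trichotomy (t / y) (t' / y) with hlt | heq | hlt
      · have := Nat.mul_le_mul_left y (Nat.succ_le_of_lt hlt)
        rw [Nat.mul_succ] at this
        omega
      · rw [heq] at h3 htt ⊢
        omega
      · have := Nat.mul_le_mul_left y (Nat.succ_le_of_lt hlt)
        rw [Nat.mul_succ] at this
        omega
    refine ⟨(range (y * (n / (4 * y)))).image s, fun a => a + (y + y), ?_, ?_, ?_, ?_⟩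
    · intro a _ b _ hab
      simpa using hab
    · rw [disjoint_left]
      intro a ha ha'
      simp only [mem_image] at ha ha'
      obtain ⟨t, -, rfl⟩ := ha
      obtain ⟨_, ⟨t', -, rfl⟩, ht⟩ := ha'
      have := (hs t t' (by omega)).1
      omega
    · intro a ha
      obtain ⟨t, ht, rfl⟩ := mem_image.1 ha
      have ht : t / y < n / (4 * y) := Nat.div_lt_of_lt_mul (mem_range.1 ht)
      have h1 := Nat.mod_lt t hy
      have h2 := Nat.mul_le_mul_left y (Nat.succ_le_of_lt ht)
      have h3 := Nat.mul_div_le n (4 * y)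
      rw [Nat.mul_succ] at h2
      simp only [s, mul_assoc] at h3 ⊢
      refine ⟨⟨_, rfl⟩, by omega, ⟨2 * (y * (t / y)) + t % y + y, by omega⟩, by omega,
        Or.inr trivial⟩
    · rw [card_image_of_injective _ fun t t' ht => (hs t t' (Or.inr ht)).2, card_range]
      have h1 := Nat.div_add_mod n (4 * y)
      have h2 := Nat.mod_lt n (show 0 < 4 * y by omega)
      have h3 : 1 ≤ n / (4 * y) := by
        rw [Nat.le_div_iff_mul_le (by omega)]
        omega
      have h4 := Nat.mul_le_mul_left y h3
      rw [mul_assoc] at h1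
      omega
  · refine ⟨(range ((y + y) / 4)).image fun i => 2 * i + 1, fun a => y + y - a, ?_, ?_, ?_, ?_⟩
    · intro a ha b hb hab
      simp only [coe_image, Set.mem_image, coe_range, Set.mem_Iio] at ha hb hab
      omega
    · rw [disjoint_left]
      intro a ha ha'
      simp only [mem_image, mem_range] at ha ha'
      obtain ⟨i, hi, rfl⟩ := ha
      obtain ⟨_, ⟨j, hj, rfl⟩, hij⟩ := ha'
      omega
    · intro a ha
      obtain ⟨i, hi, rfl⟩ := mem_image.1 ha
      rw [mem_range] at hi
      dsimp only
      exact ⟨⟨_, rfl⟩, by omega, ⟨y - i - 1, by omega⟩, by omega, Or.inl (by omega)⟩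
    · rw [card_image_of_injective _ fun i j hij => by simpa using hij, card_range]
      omega

lemma card_odd_Icc (n : ℕ) : #{a ∈ Icc 1 n | Odd a} = (n + 1) / 2 := by
  have : {a ∈ Icc 1 n | Odd a} = (range ((n + 1) / 2)).image fun i => 2 * i + 1 := by
    ext a
    simp only [mem_filter, mem_Icc, mem_image, mem_range]
    constructor
    · rintro ⟨h, k, rfl⟩
      exact ⟨k, by omega, rfl⟩
    · rintro ⟨k, hk, rfl⟩
      exact ⟨by omega, k, rfl⟩
  rw [this, card_image_of_injective _ fun i j hij => by simpa using hij, card_range]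

lemma numRSF_le_pow (r n c d : ℕ) (hr : 6 ≤ r) (hc0 : 0 < c) (hc : 36 * c ≤ n)
    (hd : 36 * d ≤ n) (A : Finset ℕ) (hA : A ⊆ Icc 1 n) (hcard : #A = (n + 1) / 2 + c)
    (hEven : #{a ∈ A | ¬ Odd a} ≤ d) : numRSF r A ≤ r ^ ((n + 1) / 2) := by
  have hsplit := card_filter_add_card_filter_not (s := A) (fun a => Odd a)
  have hOsub : {a ∈ A | Odd a} ⊆ {a ∈ Icc 1 n | Odd a} := filter_subset_filter _ hA
  have hOle := card_le_card hOsub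
  have hMiss := card_sdiff_of_subset hOsub
  rw [card_odd_Icc] at hOle hMiss
  obtain ⟨x, hx⟩ : ({a ∈ A | ¬ Odd a} : Finset ℕ).Nonempty := card_pos.1 (by omega)
  obtain ⟨hxA, hxodd⟩ := mem_filter.1 hx
  have hxn := mem_Icc.1 (hA hxA)
  obtain ⟨L₀, p, hinj, hdisj, hL₀, hL₀card⟩ :=
    exists_odd_matching n x hxn.1 hxn.2 (Nat.not_odd_iff_even.1 hxodd)
  have hbad : #{a ∈ L₀ | ¬ (a ∈ A ∧ p a ∈ A)} ≤
      #({a ∈ Icc 1 n | Odd a} \ {a ∈ A | Odd a}) := by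
    apply card_le_card_of_injOn fun a => if a ∈ A then p a else a
    · intro a ha
      simp only [coe_filter, Set.mem_ofPred_eq] at ha
      obtain ⟨h1, h2, h3, h4, -⟩ := hL₀ a ha.1
      have := h1.pos
      have := h3.pos
      simp only [coe_sdiff, coe_filter, Set.mem_sdiff, Set.mem_ofPred_eq, mem_Icc]
      split_ifs <;> grind
    · intro a ha b hb hab
      simp only [coe_filter, Set.mem_ofPred_eq] at ha hb
      have h1 : ∀ u ∈ L₀, ∀ v ∈ L₀, p u ≠ v := fun u hu v hv huv =>
        disjoint_left.1 hdisj hv (mem_image.2 ⟨u, hu, huv⟩)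
      dsimp only at hab
      split_ifs at hab
      · exact hinj ha.1 hb.1 hab
      · exact (h1 a ha.1 b hb.1 hab).elim
      · exact (h1 b hb.1 a ha.1 hab.symm).elim
      · exact hab
  have hL₀split := card_filter_add_card_filter_not (s := L₀) (fun a => a ∈ A ∧ p a ∈ A)
  obtain ⟨L, hL, hLcard⟩ := exists_subset_card_eq
    (show 3 * c ≤ #{a ∈ L₀ | a ∈ A ∧ p a ∈ A} by omega)
  have hLL₀ : L ⊆ L₀ := hL.trans (filter_subset _ _)
  have hxL : x ∉ L ∪ L.image p := by
    intro hx'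
    rcases mem_union.1 hx' with hx' | hx'
    · exact hxodd (hL₀ x (hLL₀ hx')).1
    · obtain ⟨a, ha, rfl⟩ := mem_image.1 hx'
      exact hxodd (hL₀ a (hLL₀ ha)).2.2.1
  have hbound := numRSF_le_of_matching r A L p x hxA hxL (hinj.mono hLL₀)
    (hdisj.mono hLL₀ (image_subset_image hLL₀)) (fun a ha => (mem_filter.1 (hL ha)).2.1)
    (fun a ha => (mem_filter.1 (hL ha)).2.2) (fun a ha => (hL₀ a (hLL₀ ha)).2.2.2.2)
  have hr3 : (3 * r) ^ 3 ≤ r ^ 5 := by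
    calc (3 * r) ^ 3 = 27 * r ^ 3 := by ring
      _ ≤ (r * r) * r ^ 3 := Nat.mul_le_mul_right _ (by nlinarith)
      _ = r ^ 5 := by ring
  calc numRSF r A ≤ r ^ (#A - 2 * #L) * (3 * r) ^ #L := hbound
    _ = r ^ (#A - 2 * #L) * ((3 * r) ^ 3) ^ c := by rw [hLcard, pow_mul]
    _ ≤ r ^ (#A - 2 * #L) * (r ^ 5) ^ c := by gcongr
    _ = r ^ ((n + 1) / 2) := by
        rw [← pow_mul, ← pow_add]
        congr 1
        omega

theorem stmt_19 (r : ℕ) (hr : 8 ≤ r) (ε : ℝ) (hε : 0 < ε) (hε' : ε ≤ 1 / 36) :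
    ∃ n₀ : ℕ, ∀ n : ℕ, n₀ ≤ n → ∀ c : ℕ, 1 < c → (c : ℝ) ≤ ε * n →
      ∀ A ⊆ Finset.Icc 1 n, A.card = (n + 1) / 2 + c →
      (∃ B C : Finset ℕ, A = B ∪ C ∧ Disjoint B C ∧
        (∀ b ∈ B, Odd b) ∧ (C.card : ℝ) ≤ ε * n) →
      (numRSF r A : ℝ) < (r : ℝ) ^ ((n + 1) / 2) * (3 - 2 / (r : ℝ)) := by
  refine ⟨0, fun n _ c hc1 hc A hA hcard ⟨B, C, hABC, _, hB, hC⟩ => ?_⟩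
  have to_nat : ∀ k : ℕ, (k : ℝ) ≤ ε * n → 36 * k ≤ n := by
    intro k hk
    have h : ε * n ≤ 1 / 36 * n := by gcongr
    have : (36 * k : ℝ) ≤ n := by linarith
    exact_mod_cast this
  have hEven : #{a ∈ A | ¬ Odd a} ≤ #C := by
    apply card_le_card
    intro a ha
    obtain ⟨haA, hodd⟩ := mem_filter.1 ha
    rw [hABC] at haA
    exact (mem_union.1 haA).resolve_left fun h => hodd (hB a h)
  have hle := numRSF_le_pow r n c #C (by omega) (by omega) (to_nat c hc) (to_nat _ hC)
    A hA hcard hEven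
  have hr8 : (8 : ℝ) ≤ r := by exact_mod_cast hr
  have hdiv : 2 / (r : ℝ) ≤ 1 := by
    rw [div_le_one (by linarith)]
    linarith
  calc (numRSF r A : ℝ) ≤ (r : ℝ) ^ ((n + 1) / 2) := by exact_mod_cast hle
    _ < (r : ℝ) ^ ((n + 1) / 2) * (3 - 2 / (r : ℝ)) :=
        lt_mul_of_one_lt_right (by positivity) (by linarith)
end
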